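/- arXiv:2007.08447 — 2 statements merged into one kernel-verified Lean document; each statement's English description precedes it below -/
import Mathlib

section
/- There exists a strategy x ∈ 𝒳 that is optimal for the leader (i.e., P(x) ≥ P(x') for all x' ∈ 𝒳) and is balanced. -/
open Finset

/-- The leader's strategy set 𝒳. -/
def leaderSet (n : ℕ) (Rl : ℝ) : Set (Fin n → ℝ) :=
  {x | (∀ i, 0 ≤ x i) ∧ ∑ i, x i ≤ Rl}

/-- The follower's strategy set 𝒴. -/
def followerSet (n : ℕ) (a : Fin n → ℝ) (Rf : ℝ) : Set (Fin n → ℝ) :=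
  {y | (∀ i, 0 ≤ y i ∧ y i ≤ a i) ∧ ∑ i, y i ≤ Rf}

/-- Total production after destruction P(x,y). -/
noncomputable def totProd (n : ℕ) (p a : Fin n → ℝ) (x y : Fin n → ℝ) : ℝ :=
  ∑ i, p i * x i * (1 - y i / a i)

/-- Worst case total production after destruction P(x) = min over 𝒴. -/
noncomputable def worstProd (n : ℕ) (p a : Fin n → ℝ) (Rf : ℝ) (x : Fin n → ℝ) : ℝ :=
  sInf (totProd n p a x '' followerSet n a Rf)

/-- The composed net production rate p̄(S). -/
noncomputable def pbar (n : ℕ) (p a : Fin n → ℝ) (Rf : ℝ) (S : Finset (Fin n)) : ℝ :=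
  if S = ∅ then 0
  else max ((∑ i ∈ S, a i - Rf) / (∑ i ∈ S, a i / p i)) 0

/-- A balanced strategy with support S. -/
def BalancedStrategy (n : ℕ) (p a : Fin n → ℝ) (Rl : ℝ)
    (x : Fin n → ℝ) (S : Finset (Fin n)) : Prop :=
  ∑ i, x i = Rl ∧ (∀ i ∈ S, 0 < x i) ∧
  (∀ i ∈ S, ∀ j ∈ S, p i * x i / a i = p j * x j / a j) ∧
  ∀ i, i ∉ S → x i = 0

/-- A semi-balanced strategy with support S and extra facility r. -/
def SemiBalancedStrategy (n : ℕ) (p a : Fin n → ℝ) (Rl : ℝ)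
    (x : Fin n → ℝ) (S : Finset (Fin n)) (r : Fin n) : Prop :=
  r ∉ S ∧ ∑ i, x i = Rl ∧ (∀ i ∈ insert r S, 0 < x i) ∧
  (∀ i ∈ S, ∀ j ∈ S, p i * x i / a i = p j * x j / a j) ∧
  (∀ i ∈ S, p r * x r / a r < p i * x i / a i) ∧
  ∀ i, i ∉ insert r S → x i = 0

/-- The net production per unit of leader resources guaranteed by the balanced strategy with support
`S`. -/
noncomputable def netRate {n : ℕ} (p a : Fin n → ℝ) (Rf : ℝ) (S : Finset (Fin n)) : ℝ :=
  (∑ i ∈ S, a i - Rf) / (∑ i ∈ S, a i / p i)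

/-- The strategy distributing `Rl` over `S` proportionally to `a i / p i`. -/
noncomputable def balancedOn {n : ℕ} (p a : Fin n → ℝ) (Rl : ℝ) (S : Finset (Fin n)) :
    Fin n → ℝ :=
  fun i => if i ∈ S then Rl * (a i / p i) / (∑ j ∈ S, a j / p j) else 0

lemma sum_div_pos {n : ℕ} {p a : Fin n → ℝ} (hp : ∀ i, 0 < p i) (ha : ∀ i, 0 < a i)
    {S : Finset (Fin n)} (hS : S.Nonempty) : 0 < ∑ i ∈ S, a i / p i :=
  sum_pos (fun i _ => div_pos (ha i) (hp i)) hS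

lemma balancedStrategy_balancedOn {n : ℕ} {p a : Fin n → ℝ} (hp : ∀ i, 0 < p i)
    (ha : ∀ i, 0 < a i) {Rl : ℝ} (hRl : 0 < Rl) {S : Finset (Fin n)} (hS : S.Nonempty) :
    BalancedStrategy n p a Rl (balancedOn p a Rl S) S := by
  have hc := sum_div_pos hp ha hS
  refine ⟨?_, fun i hi => ?_, fun i hi j hj => ?_, fun i hi => by simp [balancedOn, hi]⟩
  · simp only [balancedOn, sum_ite_mem, univ_inter]
    rw [← sum_div, ← mul_sum, mul_div_assoc, div_self hc.ne', mul_one]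
  · have := div_pos (ha i) (hp i)
    simp only [balancedOn, hi, if_true]
    positivity
  · have h (k : Fin n) (hk : k ∈ S) :
        p k * balancedOn p a Rl S k / a k = Rl / (∑ j ∈ S, a j / p j) := by
      have := (ha k).ne'
      have := (hp k).ne'
      simp only [balancedOn, hk, if_true]
      generalize (∑ j ∈ S, a j / p j) = c at hc
      field_simp
    rw [h i hi, h j hj]

/-- Against any destruction, the balanced strategy on `S` produces at least `Rl * netRate S`. -/
lemma mul_netRate_le_worstProd {n : ℕ} {p a : Fin n → ℝ} (hp : ∀ i, 0 < p i)
    (ha : ∀ i, 0 < a i) {Rl Rf : ℝ} (hRl : 0 < Rl) (hRf : 0 < Rf) {S : Finset (Fin n)}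
    (hS : S.Nonempty) :
    Rl * netRate p a Rf S ≤ worstProd n p a Rf (balancedOn p a Rl S) := by
  have hc := sum_div_pos hp ha hS
  refine le_csInf ⟨_, 0, ⟨fun i => ⟨le_rfl, (ha i).le⟩, by simpa using hRf.le⟩, rfl⟩ ?_
  rintro _ ⟨y, ⟨hy, hysum⟩, rfl⟩
  have htot : totProd n p a (balancedOn p a Rl S) y =
      Rl / (∑ j ∈ S, a j / p j) * (∑ i ∈ S, a i - ∑ i ∈ S, y i) := by
    rw [← sum_sub_distrib, mul_sum, totProd, ← sum_subset (subset_univ S)]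
    · refine sum_congr rfl fun i hi => ?_
      have := (ha i).ne'
      have := (hp i).ne'
      simp only [balancedOn, hi, if_true]
      generalize (∑ j ∈ S, a j / p j) = c at hc
      field_simp
    · intro i _ hi
      simp [balancedOn, hi]
  have hyS : ∑ i ∈ S, y i ≤ Rf :=
    (sum_le_sum_of_subset_of_nonneg (subset_univ S) fun i _ _ => (hy i).1).trans hysum
  rw [htot, netRate, ← mul_div_assoc, mul_div_right_comm]
  gcongr

/-- If `M` bounds every net rate, the follower can lower every production rate to at most `M`. -/
lemma worstProd_le_mul {n : ℕ} {p a : Fin n → ℝ} (hp : ∀ i, 0 < p i) (ha : ∀ i, 0 < a i)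
    {Rl Rf M : ℝ} (hRf : 0 < Rf) (hM : 0 ≤ M)
    (hmax : ∀ S : Finset (Fin n), S.Nonempty → netRate p a Rf S ≤ M)
    {x : Fin n → ℝ} (hx : x ∈ leaderSet n Rl) : worstProd n p a Rf x ≤ Rl * M := by
  obtain ⟨hx0, hxsum⟩ := hx
  let y : Fin n → ℝ := fun i => if M < p i then a i - M * (a i / p i) else 0
  have hy : y ∈ followerSet n a Rf := by
    refine ⟨fun i => ?_, ?_⟩
    · have hdiv := div_pos (ha i) (hp i)
      by_cases h : M < p i
      · simp only [y, h, if_true]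
        have h1 : M * (a i / p i) ≤ p i * (a i / p i) := by gcongr
        rw [mul_div_cancel₀ _ (hp i).ne'] at h1
        exact ⟨by linarith, by nlinarith⟩
      · simp [y, h, (ha i).le]
    · simp only [y]
      rw [← sum_filter, sum_sub_distrib, ← mul_sum]
      rcases (univ.filter fun i => M < p i).eq_empty_or_nonempty with h | h
      · simp [h, hRf.le]
      · have := hmax _ h
        rw [netRate, div_le_iff₀ (sum_div_pos hp ha h)] at this
        linarith
  have hbdd : BddBelow (totProd n p a x '' followerSet n a Rf) := by
    refine ⟨0, ?_⟩
    rintro _ ⟨z, ⟨hz, -⟩, rfl⟩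
    refine sum_nonneg fun i _ => mul_nonneg (mul_nonneg (hp i).le (hx0 i)) ?_
    exact sub_nonneg.2 ((div_le_one (ha i)).2 (hz i).2)
  calc worstProd n p a Rf x ≤ totProd n p a x y := csInf_le hbdd ⟨y, hy, rfl⟩
    _ ≤ ∑ i, x i * M := by
        refine sum_le_sum fun i _ => ?_
        have hai := (ha i).ne'
        have hpi := (hp i).ne'
        by_cases h : M < p i
        · refine le_of_eq ?_
          simp only [y, h, if_true]
          field_simp
          ring
        · simp only [y, h, if_false, zero_div, sub_zero, mul_one]
          rw [mul_comm]
          exact mul_le_mul_of_nonneg_left (not_lt.1 h) (hx0 i)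
    _ ≤ Rl * M := by
        rw [← sum_mul]
        gcongr

theorem existsOptimalBalanced {n : ℕ} (hn : 0 < n) (p a : Fin n → ℝ)
    (hp : ∀ i, 0 < p i) (hpmono : ∀ i j : Fin n, i ≤ j → p j ≤ p i)
    (ha : ∀ i, 0 < a i) (Rl Rf : ℝ) (hRl : 0 < Rl) (hRf : 0 < Rf)
    (hRfa : Rf < ∑ i, a i) :
    ∃ x ∈ leaderSet n Rl,
      (∀ x' ∈ leaderSet n Rl, worstProd n p a Rf x' ≤ worstProd n p a Rf x) ∧
      ∃ S : Finset (Fin n), BalancedStrategy n p a Rl x S := by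
  have huniv : (univ : Finset (Fin n)).Nonempty := ⟨⟨0, hn⟩, mem_univ _⟩
  obtain ⟨S, hS, hmax⟩ := exists_max_image
    (univ.filter fun S : Finset (Fin n) => S.Nonempty) (netRate p a Rf)
    ⟨univ, by simpa using huniv⟩
  simp only [mem_filter, mem_univ, true_and] at hS hmax
  have hM : 0 ≤ netRate p a Rf S :=
    (div_nonneg (sub_nonneg.2 hRfa.le) (sum_div_pos hp ha huniv).le).trans (hmax univ huniv)
  have hbal := balancedStrategy_balancedOn hp ha hRl hS
  refine ⟨balancedOn p a Rl S, ⟨fun i => ?_, hbal.1.le⟩, fun x' hx' => ?_, S, hbal⟩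
  · by_cases hi : i ∈ S
    · exact (hbal.2.1 i hi).le
    · exact (hbal.2.2.2 i hi).ge
  · exact (worstProd_le_mul hp ha hRf hM hmax hx').trans
      (mul_netRate_le_worstProd hp ha hRl hRf hS)
end

section
/- Let i* = max{ j ∈ {1,...,n} : p_j > p̄({1,...,j−1}) }, which is well defined since p_1 > 0 = p̄(∅). Then p̄({1,...,i*}) ≥ p̄({1,...,j}) for every j ∈ {1,...,n}; that is, the prefix {1,...,i*} maximizes the composed net production rate among all prefixes of N. -/
open Finset

theorem pbar_nonneg {n : ℕ} (p a : Fin n → ℝ) (Rf : ℝ) (S : Finset (Fin n)) :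
    0 ≤ pbar n p a Rf S := by
  unfold pbar
  split_ifs
  · exact le_rfl
  · exact le_max_right _ _

/-- A nonnegative `c` bounds the net production rate of `S` iff the surplus of `S` over the
rate `c` does not exceed `Rf`. -/
theorem pbar_le_iff {n : ℕ} {p a : Fin n → ℝ} {Rf : ℝ} (hp : ∀ i, 0 < p i)
    (ha : ∀ i, 0 < a i) (hRf : 0 ≤ Rf) {c : ℝ} (hc : 0 ≤ c) (S : Finset (Fin n)) :
    pbar n p a Rf S ≤ c ↔ ∑ i ∈ S, (a i - c * (a i / p i)) ≤ Rf := by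
  unfold pbar
  split_ifs with hS
  · simp [hS, hc, hRf]
  · have hpos : 0 < ∑ i ∈ S, a i / p i :=
      Finset.sum_pos (fun i _ => div_pos (ha i) (hp i)) (Finset.nonempty_iff_ne_empty.mpr hS)
    rw [max_le_iff, and_iff_left hc, div_le_iff₀ hpos, Finset.sum_sub_distrib,
      ← Finset.mul_sum, sub_le_comm]

/-- If the rate of `S` is at most `p k`, then so is the rate of `S` with `k` added. -/
theorem pbar_insert_le {n : ℕ} {p a : Fin n → ℝ} {Rf : ℝ} (hp : ∀ i, 0 < p i)
    (ha : ∀ i, 0 < a i) (hRf : 0 ≤ Rf) {S : Finset (Fin n)} {k : Fin n} (hk : k ∉ S)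
    (h : pbar n p a Rf S ≤ p k) : pbar n p a Rf (insert k S) ≤ p k := by
  rw [pbar_le_iff hp ha hRf (hp k).le] at h ⊢
  rw [Finset.sum_insert hk, mul_div_cancel₀ _ (hp k).ne', sub_self, zero_add]
  exact h

theorem prefixIstarMaximizesPbar {n : ℕ} (hn : 0 < n) (p a : Fin n → ℝ)
    (hp : ∀ i, 0 < p i) (hpmono : ∀ i j : Fin n, i ≤ j → p j ≤ p i)
    (ha : ∀ i, 0 < a i) (Rf : ℝ) (hRf : 0 < Rf) (hRfa : Rf < ∑ i, a i)
    (istar : Fin n)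
    (histar1 : pbar n p a Rf (Finset.filter (fun i => i < istar) Finset.univ) < p istar)
    (histar2 : ∀ j : Fin n,
      pbar n p a Rf (Finset.filter (fun i => i < j) Finset.univ) < p j → j ≤ istar) :
    ∀ j : Fin n,
      pbar n p a Rf (Finset.filter (fun i => i ≤ j) Finset.univ) ≤
        pbar n p a Rf (Finset.filter (fun i => i ≤ istar) Finset.univ) := by
  intro j
  have hpeak : pbar n p a Rf (Finset.filter (fun i => i ≤ istar) Finset.univ) ≤ p istar := by
    have hins : Finset.filter (fun i => i ≤ istar) Finset.univ =
        insert istar (Finset.filter (fun i => i < istar) Finset.univ) := by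
      ext i
      simp [le_iff_eq_or_lt]
    rw [hins]
    exact pbar_insert_le hp ha hRf.le (by simp) histar1.le
  have htail : ∀ i, istar < i →
      p i ≤ pbar n p a Rf (Finset.filter (fun i => i ≤ istar) Finset.univ) := by
    intro i hi
    let k : Fin n := ⟨istar + 1, lt_of_le_of_lt (Nat.succ_le_of_lt hi) i.isLt⟩
    have hlt : ∀ l : Fin n, l < k ↔ l ≤ istar := fun l => Nat.lt_succ_iff
    have hk := mt (histar2 k) (not_le.mpr (show istar < k from Nat.lt_succ_self _))
    simp only [hlt, not_lt] at hk
    exact (hpmono k i (Nat.succ_le_of_lt hi)).trans hk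
  have hV := pbar_nonneg p a Rf (Finset.filter (fun i => i ≤ istar) Finset.univ)
  have hself := (pbar_le_iff hp ha hRf.le hV _).mp le_rfl
  rw [pbar_le_iff hp ha hRf.le hV]
  refine le_trans ?_ hself
  generalize pbar n p a Rf (Finset.filter (fun i => i ≤ istar) Finset.univ) = V at *
  have hfactor : ∀ i, a i - V * (a i / p i) = (p i - V) * (a i / p i) := fun i => by
    rw [sub_mul, mul_div_cancel₀ _ (hp i).ne']
  have hratio : ∀ i, 0 ≤ a i / p i := fun i => (div_pos (ha i) (hp i)).le
  simp only [hfactor]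
  rw [Finset.sum_filter, Finset.sum_filter]
  refine Finset.sum_le_sum fun i _ => ?_
  by_cases hi : i ≤ istar
  · have hterm : 0 ≤ (p i - V) * (a i / p i) :=
      mul_nonneg (sub_nonneg.mpr (hpeak.trans (hpmono i istar hi))) (hratio i)
    rw [if_pos hi]
    split_ifs
    · exact le_rfl
    · exact hterm
  · have hterm : (p i - V) * (a i / p i) ≤ 0 :=
      mul_nonpos_of_nonpos_of_nonneg (sub_nonpos.mpr (htail i (not_le.mp hi))) (hratio i)
    rw [if_neg hi]
    split_ifs
    · exact hterm
    · exact le_rfl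
end
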